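/- arXiv:2308.16472 — 4 statements merged into one kernel-verified Lean document; each statement's English description precedes it below -/
import Mathlib

section
/- Let F be an R-good filter of formal non-Archimedean balls. Then the map |aT − b|_F := inf_{B_q(k) ∈ F} max(|a·k − b|, |a|·q) defines a bounded K-seminorm on 𝒜_Lin; in particular, |b|_F = |b| for constants b ∈ K, |aT|_F = |a|·|T|_F, |f + f'|_F ≤ max(|f|_F, |f'|_F) whenever f, f', f+f' ∈ 𝒜_Lin, and |aT − b|_F ≤ max(|a|·R, |b|). -/
open Filter Polynomial PowerSeries

/-- `K` is complete with respect to the multiplicative norm `v`: every Cauchy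
sequence (with respect to the distance induced by `v`) converges. -/
def IsNormComplete {K : Type*} [Field K] (v : MulRingNorm K) : Prop :=
  ∀ s : ℕ → K,
    (∀ ε : ℝ, 0 < ε → ∃ N : ℕ, ∀ m ≥ N, ∀ n ≥ N, v (s m - s n) < ε) →
    ∃ a : K, ∀ ε : ℝ, 0 < ε → ∃ N : ℕ, ∀ n ≥ N, v (s n - a) < ε

/-- `F` is an `R`-good filter of formal non-Archimedean balls.  A formal ball
`B_q(k)` is encoded as the pair `(k, q) : K × ℚ` with `v k ≤ R` (i.e. `k ∈ K_R`) and
`0 < q`; the inclusion `B_{q'}(k') ⊆ B_q(k)` means `v (k - k') < q ∧ q' ≤ q`. -/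
structure IsRGoodFilter {K : Type*} [Field K] (v : MulRingNorm K) (R : ℝ) (F : Set (K × ℚ)) :
    Prop where
  /-- `F` is nonempty -/
  nonempty : F.Nonempty
  /-- every member of `F` is a formal ball: its center lies in `K_R`, its radius is positive -/
  isBall : ∀ p ∈ F, v p.1 ≤ R ∧ (0 : ℚ) < p.2
  /-- `F` is upward closed under inclusion of formal balls -/
  upward : ∀ p ∈ F, ∀ p' : K × ℚ, v p'.1 ≤ R →
    v (p'.1 - p.1) < (p'.2 : ℝ) → p.2 ≤ p'.2 → p' ∈ F
  /-- `F` is closed under pairwise intersections: any two balls of `F` contain a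
  common ball of `F` -/
  directed : ∀ p ∈ F, ∀ p' ∈ F, ∃ r ∈ F,
    (v (p.1 - r.1) < (p.2 : ℝ) ∧ r.2 ≤ p.2) ∧ (v (p'.1 - r.1) < (p'.2 : ℝ) ∧ r.2 ≤ p'.2)
  /-- all balls `B_q(k)` with `k ∈ K_R` and rational `q > R` belong to `F` -/
  large : ∀ k : K, v k ≤ R → ∀ q : ℚ, R < (q : ℝ) → (k, q) ∈ F
  /-- for every ball in `F` there is a ball in `F` of strictly smaller radius -/
  rounded : ∀ p ∈ F, ∃ p' ∈ F, p'.2 < p.2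

/-- A bounded `K`-seminorm on the space `𝒜_Lin` of linear polynomials, where the
pair `(a, b) : K × K` encodes the linear polynomial `a·T − b` (so `(1, c)` is `T − c`,
`(0, b)` is the constant `−b`, and `(1, 0)` is `T`). -/
structure IsKSeminorm {K : Type*} [Field K] (v : MulRingNorm K) (R : ℝ) (x : K × K → ℝ) :
    Prop where
  /-- `x` is valued in `[0, ∞)` -/
  nonneg : ∀ p : K × K, 0 ≤ x p
  /-- `x` preserves constants: `|b|_x = |b|` -/
  const : ∀ b : K, x (0, b) = v b
  /-- semi-multiplicativity: `|a·T|_x = |a| · |T|_x` -/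
  smul : ∀ a : K, x (a, 0) = v a * x (1, 0)
  /-- the ultrametric inequality: `|f + f'|_x ≤ max |f|_x |f'|_x` -/
  ultra : ∀ p p' : K × K, x (p.1 + p'.1, p.2 + p'.2) ≤ max (x p) (x p')
  /-- boundedness by the Gauss norm: `|a·T − b|_x ≤ max (|a|·R) |b|` -/
  bounded : ∀ a b : K, x (a, b) ≤ max (v a * R) (v b)

/-- The collection `F_x` of formal balls attached to a bounded `K`-seminorm `x`:
`F_x = {B_q(k) : k ∈ K_R, q ∈ ℚ_{>0}, |T − k|_x < q}`. -/
def seminormFilter {K : Type*} [Field K] (v : MulRingNorm K) (R : ℝ) (x : K × K → ℝ) :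
    Set (K × ℚ) :=
  {p | v p.1 ≤ R ∧ 0 < p.2 ∧ x (1, p.1) < (p.2 : ℝ)}

/-- The `K`-seminorm induced by a filter `F` of formal balls:
`|a·T − b|_F = inf_{B_q(k) ∈ F} max |a·k − b| (|a|·q)`. -/
noncomputable def inducedSeminorm {K : Type*} [Field K] (v : MulRingNorm K)
    (F : Set (K × ℚ)) (a b : K) : ℝ :=
  ⨅ p : F, max (v (a * (p : K × ℚ).1 - b)) (v a * ((p : K × ℚ).2 : ℝ))

/-- The value of `a·T − b` on a formal ball decreases when passing to a smaller ball. -/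
theorem ballValue_mono {K : Type*} [Field K] (v : MulRingNorm K) (hna : IsNonarchimedean v)
    (p r : K × ℚ) (h1 : v (p.1 - r.1) < (p.2 : ℝ)) (h2 : r.2 ≤ p.2) (a b : K) :
    max (v (a * r.1 - b)) (v a * (r.2 : ℝ)) ≤ max (v (a * p.1 - b)) (v a * (p.2 : ℝ)) := by
  have ha : 0 ≤ v a := apply_nonneg v a
  have h2' : (r.2 : ℝ) ≤ (p.2 : ℝ) := by exact_mod_cast h2
  apply max_le
  · have e : a * r.1 - b = (a * p.1 - b) + -(a * (p.1 - r.1)) := by ring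
    rw [e]
    refine (hna _ _).trans (max_le_max le_rfl ?_)
    rw [map_neg_eq_map, map_mul]
    exact mul_le_mul_of_nonneg_left h1.le ha
  · exact le_max_of_le_right (mul_le_mul_of_nonneg_left h2' ha)

/-- The infimum is below each of its terms. -/
theorem inducedSeminorm_le {K : Type*} [Field K] (v : MulRingNorm K)
    (F : Set (K × ℚ)) (a b : K) (p : K × ℚ) (hp : p ∈ F) :
    inducedSeminorm v F a b ≤ max (v (a * p.1 - b)) (v a * (p.2 : ℝ)) := by
  have hb : BddBelow (Set.range fun p : F =>
      max (v (a * (p : K × ℚ).1 - b)) (v a * ((p : K × ℚ).2 : ℝ))) := by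
    refine ⟨0, ?_⟩
    rintro _ ⟨q, rfl⟩
    exact le_max_of_le_left (apply_nonneg v _)
  exact ciInf_le hb ⟨p, hp⟩

/-- For an `R`-good filter `F`, the map
`|a·T − b|_F = inf_{B_q(k) ∈ F} max |a·k − b| (|a|·q)` is a bounded `K`-seminorm on
`𝒜_Lin`: it preserves constants, is semi-multiplicative, satisfies the ultrametric
inequality, and is bounded by the Gauss norm. -/
theorem inducedSeminorm_isKSeminorm
    {K : Type*} [Field K] [IsAlgClosed K] (v : MulRingNorm K)
    (hna : IsNonarchimedean v) (hcomp : IsNormComplete v)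
    (R : ℝ) (hR : 0 < R)
    (F : Set (K × ℚ)) (hF : IsRGoodFilter v R F) :
    IsKSeminorm v R (fun p : K × K => inducedSeminorm v F p.1 p.2) := by
  have hne : Nonempty F := hF.nonempty.to_subtype
  refine ⟨?_, ?_, ?_, ?_, ?_⟩
  · intro p
    exact Real.iInf_nonneg fun q => le_max_of_le_left (apply_nonneg v _)
  · intro b
    have hv : 0 ≤ v b := apply_nonneg v b
    simp [inducedSeminorm, hv]
  · intro a
    simp only [inducedSeminorm]
    rw [Real.mul_iInf_of_nonneg (apply_nonneg v a)]
    congr 1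
    funext q
    rw [mul_max_of_nonneg _ _ (apply_nonneg v a)]
    simp
  · rintro ⟨a, b⟩ ⟨a', b'⟩
    dsimp only
    refine le_of_forall_gt fun c hc => ?_
    obtain ⟨h1, h2⟩ := max_lt_iff.mp hc
    obtain ⟨⟨p, hp⟩, h1⟩ := exists_lt_of_ciInf_lt h1
    obtain ⟨⟨p', hp'⟩, h2⟩ := exists_lt_of_ciInf_lt h2
    obtain ⟨r, hr, ⟨hr1, hr2⟩, hr3, hr4⟩ := hF.directed p hp p' hp'
    have k1 := (ballValue_mono v hna p r hr1 hr2 a b).trans_lt h1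
    have k2 := (ballValue_mono v hna p' r hr3 hr4 a' b').trans_lt h2
    refine (inducedSeminorm_le v F _ _ r hr).trans_lt ?_
    obtain ⟨k3, k4⟩ := max_lt_iff.mp k1
    obtain ⟨k5, k6⟩ := max_lt_iff.mp k2
    have hr0 : (0 : ℝ) ≤ (r.2 : ℝ) := by exact_mod_cast (hF.isBall r hr).2.le
    refine max_lt ?_ ?_
    · have e : (a + a') * r.1 - (b + b') = (a * r.1 - b) + (a' * r.1 - b') := by ring
      rw [e]
      exact (hna _ _).trans_lt (max_lt k3 k5)
    · refine (mul_le_mul_of_nonneg_right (hna a a') hr0).trans_lt ?_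
      rw [max_mul_of_nonneg _ _ hr0]
      exact max_lt k4 k6
  · intro a b
    dsimp only
    have key : ∀ q : ℚ, R < (q : ℝ) → inducedSeminorm v F a b ≤ max (v a * (q : ℝ)) (v b) := by
      intro q hq
      have h := inducedSeminorm_le v F a b (0, q) (hF.large 0 (by simpa using hR.le) q hq)
      simpa [max_comm] using h
    refine le_of_forall_gt fun c hc => ?_
    obtain ⟨h1, h2⟩ := max_lt_iff.mp hc
    have ha : 0 ≤ v a := apply_nonneg v a
    obtain ⟨q, hq, hqc⟩ : ∃ q : ℚ, R < (q : ℝ) ∧ v a * (q : ℝ) < c := by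
      rcases ha.eq_or_lt with h0 | h0
      · obtain ⟨q, hq⟩ := exists_rat_gt R
        refine ⟨q, hq, ?_⟩
        rw [← h0] at h1 ⊢
        simpa using h1
      · have h3 : R < c / v a := by rw [lt_div_iff₀ h0]; linarith
        obtain ⟨q, hq, hq2⟩ := exists_rat_btwn h3
        refine ⟨q, hq, ?_⟩
        rw [lt_div_iff₀ h0] at hq2
        linarith
    exact (key q hq).trans_lt (max_lt hqc h2)
end

section
/- Let F be an R-good filter of formal non-Archimedean balls and let |·|_F be the induced bounded K-seminorm on 𝒜_Lin, i.e. |aT − b|_F := inf_{B_q(k) ∈ F} max(|a·k − b|, |a|·q). Then F is recovered from |·|_F: for every k ∈ K_R and positive rational q, B_q(k) ∈ F if and only if |T − k|_F < q. -/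
open Filter Polynomial PowerSeries

/-- Second direction of Theorem 2.32: an `R`-good filter `F` is recovered from its
induced `K`-seminorm `|·|_F`: for every `k ∈ K_R` and positive rational `q`,
`B_q(k) ∈ F` if and only if `|T − k|_F < q`. -/
theorem rGoodFilter_eq_seminormFilter_inducedSeminorm
    {K : Type*} [Field K] [IsAlgClosed K] (v : MulRingNorm K)
    (hna : IsNonarchimedean v) (hcomp : IsNormComplete v)
    (R : ℝ) (hR : 0 < R)
    (F : Set (K × ℚ)) (hF : IsRGoodFilter v R F) :
    ∀ k : K, v k ≤ R → ∀ q : ℚ, 0 < q →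
      ((k, q) ∈ F ↔ inducedSeminorm v F 1 k < (q : ℝ)) := by
  intro k hk q hq
  have hne : Nonempty F := hF.nonempty.to_subtype
  have hsymm : ∀ a b : K, v (a - b) = v (b - a) := fun a b => map_sub_rev v a b
  unfold inducedSeminorm
  constructor
  · intro hmem
    obtain ⟨p', hp', hlt⟩ := hF.rounded _ hmem
    obtain ⟨r, hr, ⟨h1, _⟩, ⟨_, h2⟩⟩ := hF.directed _ hmem _ hp'
    have hbdd : BddBelow (Set.range fun p : F =>
        max (v ((1 : K) * (p : K × ℚ).1 - k)) (v 1 * ((p : K × ℚ).2 : ℝ))) := by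
      refine ⟨0, ?_⟩
      rintro _ ⟨p, rfl⟩
      exact le_max_of_le_left (apply_nonneg v _)
    refine lt_of_le_of_lt (ciInf_le hbdd ⟨r, hr⟩) ?_
    have h3 : (r.2 : ℝ) < (q : ℝ) := by exact_mod_cast lt_of_le_of_lt h2 hlt
    simp only [one_mul, map_one]
    exact max_lt (by rw [hsymm]; exact h1) h3
  · intro h
    obtain ⟨⟨p, hp⟩, hlt⟩ := exists_lt_of_ciInf_lt h
    simp only [one_mul, map_one] at hlt
    obtain ⟨h1, h2⟩ := max_lt_iff.mp hlt
    refine hF.upward p hp (k, q) hk (by rw [hsymm]; exact h1) ?_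
    exact_mod_cast h2.le
end

section
/- Let F be an R-good filter of formal non-Archimedean balls. Define |f|_F := inf_{B_q(k) ∈ F} |f|_{B_q(k)} for f ∈ K[T], where |f|_{B_q(k)} := max_i |c_i|·q^i with f = Σ_i c_i (T − k)^i the expansion of f around k. Then |·|_F is a multiplicative seminorm on K[T] satisfying the ultrametric inequality |f + f'|_F ≤ max(|f|_F, |f'|_F), and it is bounded by the Gauss norm: |f|_F ≤ max_i |a_i|·R^i for every f = Σ_i a_i T^i ∈ K[T]. -/
open Filter Polynomial PowerSeries

/-- The seminorm `|·|_{B_q(k)}` on `K[T]` attached to a ball of center `k` and radius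
`q`: `|f|_{B_q(k)} = max_i |c_i|·q^i`, where `f = Σ_i c_i (T − k)^i` is the expansion
of `f` around `k` (so `c_i = (taylor k f).coeff i`). -/
noncomputable def ballNorm {K : Type*} [Field K] (v : MulRingNorm K) (k : K) (q : ℝ)
    (f : Polynomial K) : ℝ :=
  ⨆ i : ℕ, v ((Polynomial.taylor k f).coeff i) * q ^ i

/-- The seminorm `|·|_F` on `K[T]` induced by a filter `F` of formal balls:
`|f|_F = inf_{B_q(k) ∈ F} |f|_{B_q(k)}`. -/
noncomputable def filterPolyNorm {K : Type*} [Field K] (v : MulRingNorm K)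
    (F : Set (K × ℚ)) (f : Polynomial K) : ℝ :=
  ⨅ p : F, ballNorm v (p : K × ℚ).1 (((p : K × ℚ).2 : ℚ) : ℝ) f

theorem aux_gauss_taylor_le {K : Type*} [Field K] (w : AbsoluteValue K ℝ)
    (hna : IsNonarchimedean w) (q : ℝ) (hq : 0 < q) (a : K) (ha : w a ≤ q) (g : Polynomial K) :
    (Polynomial.taylor a g).gaussNorm w q ≤ g.gaussNorm w q := by
  have hG := g.gaussNorm_nonneg w hq.le
  have hX : (Polynomial.X + Polynomial.C a).gaussNorm w q ≤ q := by
    refine (Polynomial.isNonarchimedean_gaussNorm w hna hq.le _ _).trans ?_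
    rw [Polynomial.gaussNorm_C, ← Polynomial.monomial_one_one_eq_X, Polynomial.gaussNorm_monomial]
    simp [ha]
  have hone : (1 : Polynomial K).gaussNorm w q = 1 := by
    rw [← Polynomial.C_1, Polynomial.gaussNorm_C, map_one]
  have hpow : ∀ n : ℕ, ((Polynomial.X + Polynomial.C a) ^ n).gaussNorm w q ≤ q ^ n := by
    intro n
    induction n with
    | zero => simp [hone]
    | succ n ih =>
      rw [pow_succ, pow_succ, Polynomial.gaussNorm_mul hna hq]
      exact mul_le_mul ih hX (Polynomial.gaussNorm_nonneg _ _ hq.le) (by positivity)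
  have key : ∀ s : Finset ℕ, (Polynomial.taylor a
      (∑ i ∈ s, Polynomial.monomial i (g.coeff i))).gaussNorm w q ≤ g.gaussNorm w q := by
    intro s
    induction s using Finset.induction_on with
    | empty => simpa using hG
    | insert i s hi ih =>
      rw [Finset.sum_insert hi, map_add]
      refine (Polynomial.isNonarchimedean_gaussNorm w hna hq.le _ _).trans (max_le ?_ ih)
      rw [Polynomial.taylor_monomial, Polynomial.gaussNorm_mul hna hq, Polynomial.gaussNorm_C]
      exact (mul_le_mul_of_nonneg_left (hpow i) (w.nonneg _)).trans (g.le_gaussNorm w hq.le i)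
  have := key g.support
  rwa [← Polynomial.as_sum_support] at this

theorem aux_gauss_mono {K : Type*} [Field K] (w : AbsoluteValue K ℝ)
    (p q : ℝ) (hp : 0 ≤ p) (hpq : p ≤ q) (g : Polynomial K) :
    g.gaussNorm w p ≤ g.gaussNorm w q := by
  obtain ⟨i, hi⟩ := Polynomial.exists_eq_gaussNorm w p g
  rw [hi]
  exact (mul_le_mul_of_nonneg_left (pow_le_pow_left₀ hp hpq i) (w.nonneg _)).trans
    (g.le_gaussNorm w (hp.trans hpq) i)

theorem aux_iSup_eq {K : Type*} [Field K] (v : MulRingNorm K) (w : AbsoluteValue K ℝ)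
    (hw : ∀ x, w x = v x) (q : ℝ) (hq : 0 ≤ q) (g : Polynomial K) :
    (⨆ i : ℕ, v (g.coeff i) * q ^ i) = g.gaussNorm w q := by
  simp only [← hw]
  apply le_antisymm
  · exact ciSup_le fun i => g.le_gaussNorm w hq i
  · obtain ⟨i, hi⟩ := Polynomial.exists_eq_gaussNorm w q g
    rw [hi]
    exact le_ciSup (f := fun i : ℕ => w (g.coeff i) * q ^ i)
      ⟨g.gaussNorm w q, by rintro _ ⟨i, rfl⟩; exact g.le_gaussNorm w hq i⟩ i

theorem aux_gauss_scale {K : Type*} [Field K] (w : AbsoluteValue K ℝ)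
    (R q : ℝ) (hR : 0 < R) (hq : R ≤ q) (g : Polynomial K) :
    g.gaussNorm w q ≤ (q / R) ^ g.natDegree * g.gaussNorm w R := by
  have h1 : 1 ≤ q / R := by rwa [le_div_iff₀ hR, one_mul]
  have hG := g.gaussNorm_nonneg w hR.le
  obtain ⟨i, hi⟩ := Polynomial.exists_eq_gaussNorm w q g
  by_cases hd : g.natDegree < i
  · rw [hi, Polynomial.coeff_eq_zero_of_natDegree_lt hd]
    simp only [map_zero, zero_mul]
    positivity
  · have e : w (g.coeff i) * q ^ i = (q / R) ^ i * (w (g.coeff i) * R ^ i) := by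
      rw [div_pow]
      field_simp
    rw [hi, e]
    exact mul_le_mul (pow_le_pow_right₀ h1 (not_lt.mp hd)) (g.le_gaussNorm w hR.le i)
      (mul_nonneg (w.nonneg _) (by positivity)) (by positivity)

/-- For an `R`-good filter `F`, the map `|f|_F = inf_{B_q(k) ∈ F} |f|_{B_q(k)}` is a
multiplicative seminorm on `K[T]` satisfying the ultrametric inequality, and it is
bounded by the Gauss norm: `|f|_F ≤ max_i |a_i|·R^i` for `f = Σ_i a_i T^i`. -/
theorem filterPolyNorm_isBoundedMultSeminorm
    {K : Type*} [Field K] [IsAlgClosed K] (v : MulRingNorm K)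
    (hna : IsNonarchimedean v) (hcomp : IsNormComplete v)
    (R : ℝ) (hR : 0 < R)
    (F : Set (K × ℚ)) (hF : IsRGoodFilter v R F) :
    (∀ f : Polynomial K, 0 ≤ filterPolyNorm v F f) ∧
    filterPolyNorm v F 0 = 0 ∧
    filterPolyNorm v F 1 = 1 ∧
    (∀ f f' : Polynomial K,
      filterPolyNorm v F (f * f') = filterPolyNorm v F f * filterPolyNorm v F f') ∧
    (∀ f f' : Polynomial K,
      filterPolyNorm v F (f + f') ≤ max (filterPolyNorm v F f) (filterPolyNorm v F f')) ∧
    (∀ f : Polynomial K, filterPolyNorm v F f ≤ ⨆ i : ℕ, v (f.coeff i) * R ^ i) := by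
  classical
  let w : AbsoluteValue K ℝ := MulRingNorm.mulRingNormEquivAbsoluteValue v
  have hw : ∀ x, w x = v x := fun x => rfl
  have hwna : IsNonarchimedean w := hna
  have hpos : ∀ p ∈ F, (0 : ℝ) < (p.2 : ℝ) := fun p hp => by exact_mod_cast (hF.isBall p hp).2
  have hball : ∀ p ∈ F, ∀ f, ballNorm v p.1 (p.2 : ℝ) f
      = (Polynomial.taylor p.1 f).gaussNorm w (p.2 : ℝ) := fun p hp f =>
    aux_iSup_eq v w hw _ (hpos p hp).le _
  have hnn : ∀ p ∈ F, ∀ f, 0 ≤ ballNorm v p.1 (p.2 : ℝ) f := fun p hp f => by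
    rw [hball p hp]; exact Polynomial.gaussNorm_nonneg _ _ (hpos p hp).le
  have hmono : ∀ p ∈ F, ∀ r ∈ F, v (p.1 - r.1) < (p.2 : ℝ) → r.2 ≤ p.2 → ∀ f,
      ballNorm v r.1 (r.2 : ℝ) f ≤ ballNorm v p.1 (p.2 : ℝ) f := by
    intro p hp r hr h1 h2 f
    rw [hball p hp, hball r hr]
    have e : Polynomial.taylor r.1 f = Polynomial.taylor (r.1 - p.1) (Polynomial.taylor p.1 f) := by
      rw [Polynomial.taylor_taylor, sub_add_cancel]
    refine (aux_gauss_mono w _ (p.2 : ℝ) (hpos r hr).le (by exact_mod_cast h2) _).trans ?_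
    rw [e]
    refine aux_gauss_taylor_le w hwna _ (hpos p hp) _ ?_ _
    rw [← w.map_neg, neg_sub]
    exact h1.le
  have hmul : ∀ p ∈ F, ∀ f g, ballNorm v p.1 (p.2 : ℝ) (f * g)
      = ballNorm v p.1 (p.2 : ℝ) f * ballNorm v p.1 (p.2 : ℝ) g := by
    intro p hp f g
    rw [hball p hp, hball p hp, hball p hp, Polynomial.taylor_mul,
      Polynomial.gaussNorm_mul hwna (hpos p hp)]
  have hadd : ∀ p ∈ F, ∀ f g, ballNorm v p.1 (p.2 : ℝ) (f + g)
      ≤ max (ballNorm v p.1 (p.2 : ℝ) f) (ballNorm v p.1 (p.2 : ℝ) g) := by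
    intro p hp f g
    rw [hball p hp, hball p hp, hball p hp, map_add]
    exact Polynomial.isNonarchimedean_gaussNorm w hwna (hpos p hp).le _ _
  have : Nonempty F := hF.nonempty.to_subtype
  have hle : ∀ p ∈ F, ∀ f, filterPolyNorm v F f ≤ ballNorm v p.1 (p.2 : ℝ) f := by
    intro p hp f
    exact ciInf_le (f := fun p : F => ballNorm v (p : K × ℚ).1 (((p : K × ℚ).2 : ℚ) : ℝ) f)
      ⟨0, by rintro _ ⟨r, rfl⟩; exact hnn r r.2 f⟩ ⟨p, hp⟩
  have hge : ∀ (c : ℝ) f, (∀ p ∈ F, c ≤ ballNorm v p.1 (p.2 : ℝ) f) → c ≤ filterPolyNorm v F f :=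
    fun c f h => le_ciInf fun p => h p p.2
  have hFnn : ∀ f, 0 ≤ filterPolyNorm v F f := fun f => hge 0 f fun p hp => hnn p hp f
  have hlt : ∀ (c : ℝ) f, filterPolyNorm v F f < c → ∃ p ∈ F, ballNorm v p.1 (p.2 : ℝ) f < c := by
    intro c f h
    by_contra! hc
    exact absurd (hge c f hc) (not_le.mpr h)
  obtain ⟨p₀, hp₀⟩ := hF.nonempty
  refine ⟨hFnn, ?_, ?_, ?_, ?_, ?_⟩
  · refine le_antisymm ((hle p₀ hp₀ 0).trans ?_) (hFnn 0)
    rw [hball p₀ hp₀]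
    simp
  · have h1 : ∀ p ∈ F, ballNorm v p.1 (p.2 : ℝ) 1 = 1 := by
      intro p hp
      rw [hball p hp, Polynomial.taylor_one, Polynomial.gaussNorm_C, map_one]
    exact le_antisymm ((hle p₀ hp₀ 1).trans (h1 p₀ hp₀).le) (hge 1 1 fun p hp => (h1 p hp).ge)
  · intro f g
    apply le_antisymm
    · have step : ∀ p ∈ F, ∀ p' ∈ F, filterPolyNorm v F (f * g)
          ≤ ballNorm v p.1 (p.2 : ℝ) f * ballNorm v p'.1 (p'.2 : ℝ) g := by
        intro p hp p' hp'
        obtain ⟨r, hr, ⟨h1, h2⟩, h3, h4⟩ := hF.directed p hp p' hp'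
        refine (hle r hr _).trans ?_
        rw [hmul r hr]
        exact mul_le_mul (hmono p hp r hr h1 h2 f) (hmono p' hp' r hr h3 h4 g) (hnn r hr g)
          (hnn p hp f)
      have e1 : filterPolyNorm v F f * filterPolyNorm v F g
          = ⨅ p : F, ballNorm v (p : K × ℚ).1 (((p : K × ℚ).2 : ℚ) : ℝ) f
            * filterPolyNorm v F g := Real.iInf_mul_of_nonneg (hFnn g) _
      rw [e1]
      refine le_ciInf fun p => ?_
      have e2 : ballNorm v (p : K × ℚ).1 (((p : K × ℚ).2 : ℚ) : ℝ) f * filterPolyNorm v F g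
          = ⨅ p' : F, ballNorm v (p : K × ℚ).1 (((p : K × ℚ).2 : ℚ) : ℝ) f
            * ballNorm v (p' : K × ℚ).1 (((p' : K × ℚ).2 : ℚ) : ℝ) g :=
        Real.mul_iInf_of_nonneg (hnn p p.2 f) _
      rw [e2]
      exact le_ciInf fun p' => step p p.2 p' p'.2
    · refine hge _ _ fun p hp => ?_
      rw [hmul p hp]
      exact mul_le_mul (hle p hp f) (hle p hp g) (hFnn g) (hnn p hp f)
  · intro f g
    by_contra! h
    obtain ⟨hf, hg⟩ := max_lt_iff.mp h
    obtain ⟨p, hp, h1⟩ := hlt _ _ hf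
    obtain ⟨p', hp', h2⟩ := hlt _ _ hg
    obtain ⟨r, hr, ⟨h3, h4⟩, h5, h6⟩ := hF.directed p hp p' hp'
    have := (hle r hr (f + g)).trans (hadd r hr f g)
    exact absurd this (not_le.mpr (max_lt ((hmono p hp r hr h3 h4 f).trans_lt h1)
      ((hmono p' hp' r hr h5 h6 g).trans_lt h2)))
  · intro f
    rw [aux_iSup_eq v w hw R hR.le f]
    have hb : ∀ x : ℝ, R < x →
        filterPolyNorm v F f ≤ (x / R) ^ f.natDegree * f.gaussNorm w R := by
      intro x hx
      obtain ⟨q, hq1, hq2⟩ := exists_rat_btwn hx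
      have hm := hF.large 0 (by simpa using hR.le) q hq1
      refine (hle _ hm f).trans ?_
      rw [hball _ hm]
      simp only [Polynomial.taylor_zero]
      refine (aux_gauss_mono w _ _ (hR.trans hq1).le hq2.le f).trans ?_
      exact aux_gauss_scale w R x hR hx.le f
    have ht : Tendsto (fun x : ℝ => (x / R) ^ f.natDegree * f.gaussNorm w R)
        (nhdsWithin R (Set.Ioi R)) (nhds (f.gaussNorm w R)) := by
      have hc : Continuous (fun x : ℝ => (x / R) ^ f.natDegree * f.gaussNorm w R) := by fun_prop
      have := hc.tendsto R
      simp only [div_self hR.ne', one_pow, one_mul] at this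
      exact this.mono_left nhdsWithin_le_nhds
    exact ge_of_tendsto ht (eventually_nhdsWithin_of_forall fun x hx => hb x hx)
end

section
/- Let F be an R-good filter and let |·|_F be the induced multiplicative seminorm on K[T] (|f|_F := inf_{B_q(k) ∈ F} max_i |c_i|·q^i, with f = Σ_i c_i (T − k)^i the expansion around k). Let f = Σ_{i=0}^∞ a_i T^i be a power series with |a_i|·R^i → 0. Then for all natural numbers M < N one has | |Σ_{i=0}^N a_i T^i|_F − |Σ_{i=0}^M a_i T^i|_F | ≤ max_{M+1 ≤ i ≤ N} |a_i|·R^i; consequently the sequence n ↦ |Σ_{i=0}^n a_i T^i|_F is a Cauchy sequence of real numbers and converges. -/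
open Filter Polynomial PowerSeries

theorem aux_sum {K ι : Type*} [Field K] (v : MulRingNorm K) (hna : IsNonarchimedean v)
    (s : Finset ι) (g : ι → K) (x c : ℝ) (hx : 0 ≤ x) (hc : 0 ≤ c)
    (h : ∀ j ∈ s, v (g j) * x ≤ c) : v (∑ j ∈ s, g j) * x ≤ c := by
  classical
  induction s using Finset.induction_on with
  | empty => simpa using hc
  | insert a s ha ih =>
    rw [Finset.sum_insert ha]
    have h1 := h a (by simp)
    have h2 := ih (fun j hj => h j (by simp [hj]))
    have h3 := mul_le_mul_of_nonneg_right (hna (g a) (∑ j ∈ s, g j)) hx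
    rcases le_total (v (g a)) (v (∑ j ∈ s, g j)) with h4 | h4
    · rw [max_eq_right h4] at h3; linarith
    · rw [max_eq_left h4] at h3; linarith

theorem aux_bdd {K : Type*} [Field K] (v : MulRingNorm K) (k : K) (q : ℝ) (f : Polynomial K) :
    BddAbove (Set.range fun i : ℕ => v ((Polynomial.taylor k f).coeff i) * q ^ i) := by
  apply Set.Finite.bddAbove
  refine Set.Finite.subset ((((Polynomial.taylor k f).support.finite_toSet).image
    (fun i : ℕ => v ((Polynomial.taylor k f).coeff i) * q ^ i)).union (Set.finite_singleton 0)) ?_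
  rintro _ ⟨i, rfl⟩
  by_cases hi : (Polynomial.taylor k f).coeff i = 0
  · right; simp [hi]
  · left; exact ⟨i, by simpa using hi, rfl⟩

theorem aux_term_le {K : Type*} [Field K] (v : MulRingNorm K) (k : K) (q : ℝ)
    (f : Polynomial K) (i : ℕ) :
    v ((Polynomial.taylor k f).coeff i) * q ^ i ≤ ballNorm v k q f :=
  le_ciSup (aux_bdd v k q f) i

theorem aux_nonneg {K : Type*} [Field K] (v : MulRingNorm K) (k : K) (q : ℝ)
    (f : Polynomial K) : 0 ≤ ballNorm v k q f :=
  le_trans (by simp) (aux_term_le v k q f 0)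

theorem aux_add {K : Type*} [Field K] (v : MulRingNorm K) (k : K) (q : ℝ) (hq : 0 ≤ q)
    (f g : Polynomial K) : ballNorm v k q (f + g) ≤ ballNorm v k q f + ballNorm v k q g := by
  refine ciSup_le fun i => ?_
  have h1 := aux_term_le v k q f i
  have h2 := aux_term_le v k q g i
  have h3 := mul_le_mul_of_nonneg_right (map_add_le_add v ((Polynomial.taylor k f).coeff i)
    ((Polynomial.taylor k g).coeff i)) (pow_nonneg hq i)
  rw [map_add, Polynomial.coeff_add]
  linarith

theorem aux_neg {K : Type*} [Field K] (v : MulRingNorm K) (k : K) (q : ℝ)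
    (f : Polynomial K) : ballNorm v k q (-f) = ballNorm v k q f := by
  simp [ballNorm]

theorem aux_taylor {K : Type*} [Field K] (v : MulRingNorm K) (hna : IsNonarchimedean v)
    (g : Polynomial K) (t : K) (q r c : ℝ) (hr : 0 ≤ r) (hrq : r ≤ q) (ht : v t ≤ q)
    (hc : 0 ≤ c) (h : ∀ j, v (g.coeff j) * q ^ j ≤ c) (i : ℕ) :
    v ((Polynomial.taylor t g).coeff i) * r ^ i ≤ c := by
  have e : (Polynomial.taylor t g).coeff i =
      ∑ j ∈ g.support, g.coeff j * (t ^ (j - i) * (j.choose i : K)) := by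
    conv_lhs => rw [g.as_sum_support]
    rw [map_sum, Polynomial.finset_sum_coeff]
    refine Finset.sum_congr rfl fun j _ => ?_
    rw [Polynomial.taylor_monomial, Polynomial.coeff_C_mul, Polynomial.coeff_X_add_C_pow]
  rw [e]
  refine aux_sum v hna _ _ _ _ (pow_nonneg hr i) hc fun j _ => ?_
  rcases lt_or_ge j i with hji | hij
  · simp [Nat.choose_eq_zero_of_lt hji, hc]
  refine le_trans ?_ (h j)
  have hn : v ((j.choose i : ℕ) : K) ≤ 1 :=
    hna.apply_natCast_le_one_of_isNonarchimedean
  rw [map_mul, map_mul, map_pow, mul_assoc]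
  refine mul_le_mul_of_nonneg_left ?_ (apply_nonneg v _)
  have hq : 0 ≤ q := hr.trans hrq
  calc v t ^ (j - i) * v ((j.choose i : ℕ) : K) * r ^ i
      ≤ q ^ (j - i) * 1 * q ^ i := by
        gcongr
    _ = q ^ j := by rw [mul_one, ← pow_add, Nat.sub_add_cancel hij]

theorem aux_mono {K : Type*} [Field K] (v : MulRingNorm K) (hna : IsNonarchimedean v)
    (f : Polynomial K) (k l : K) (q r : ℝ) (hr : 0 ≤ r) (hrq : r ≤ q) (ht : v (k - l) ≤ q) :
    ballNorm v l r f ≤ ballNorm v k q f := by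
  refine ciSup_le fun i => ?_
  have e : Polynomial.taylor l f = Polynomial.taylor (l - k) (Polynomial.taylor k f) := by
    rw [Polynomial.taylor_taylor]; congr 2; ring
  rw [e]
  exact aux_taylor v hna _ _ q r _ hr hrq (by rwa [map_sub_rev]) (aux_nonneg v k q f)
    (aux_term_le v k q f) i

theorem aux_filter_bdd {K : Type*} [Field K] (v : MulRingNorm K) (F : Set (K × ℚ))
    (f : Polynomial K) : BddBelow (Set.range fun p : F =>
      ballNorm v (p : K × ℚ).1 (((p : K × ℚ).2 : ℚ) : ℝ) f) :=
  ⟨0, by rintro _ ⟨p, rfl⟩; exact aux_nonneg v _ _ _⟩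

theorem aux_filter_le {K : Type*} [Field K] (v : MulRingNorm K) (F : Set (K × ℚ))
    (f : Polynomial K) (p : K × ℚ) (hp : p ∈ F) :
    filterPolyNorm v F f ≤ ballNorm v p.1 (p.2 : ℝ) f :=
  ciInf_le (aux_filter_bdd v F f) (⟨p, hp⟩ : F)

theorem aux_filter_add {K : Type*} [Field K] (v : MulRingNorm K) (hna : IsNonarchimedean v)
    (R : ℝ) (F : Set (K × ℚ)) (hF : IsRGoodFilter v R F) (f g : Polynomial K) :
    filterPolyNorm v F (f + g) ≤ filterPolyNorm v F f + filterPolyNorm v F g := by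
  haveI : Nonempty F := hF.nonempty.to_subtype
  rw [← sub_le_iff_le_add]
  refine le_ciInf fun p => ?_
  rw [sub_le_comm]
  refine le_ciInf fun p' => ?_
  obtain ⟨r, hr, ⟨h1, h2⟩, h3, h4⟩ := hF.directed p p.2 p' p'.2
  have hr0 : (0 : ℝ) ≤ (r.2 : ℝ) := by exact_mod_cast (hF.isBall r hr).2.le
  have a1 := aux_mono v hna f _ _ _ (r.2 : ℝ) hr0 (by exact_mod_cast h2) h1.le
  have a2 := aux_mono v hna g _ _ _ (r.2 : ℝ) hr0 (by exact_mod_cast h4) h3.le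
  have a3 := aux_add v r.1 (r.2 : ℝ) hr0 f g
  have a4 := aux_filter_le v F (f + g) r hr
  linarith

theorem aux_filter_neg {K : Type*} [Field K] (v : MulRingNorm K) (F : Set (K × ℚ))
    (f : Polynomial K) : filterPolyNorm v F (-f) = filterPolyNorm v F f := by
  simp [filterPolyNorm, aux_neg]

theorem aux_filter_sub {K : Type*} [Field K] (v : MulRingNorm K) (hna : IsNonarchimedean v)
    (R : ℝ) (F : Set (K × ℚ)) (hF : IsRGoodFilter v R F) (f g : Polynomial K) :
    |filterPolyNorm v F f - filterPolyNorm v F g| ≤ filterPolyNorm v F (f - g) := by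
  have h1 := aux_filter_add v hna R F hF (f - g) g
  have h2 := aux_filter_add v hna R F hF (-(f - g)) f
  rw [aux_filter_neg] at h2
  rw [sub_add_cancel] at h1
  rw [show -(f - g) + f = g by ring] at h2
  rw [abs_le]; constructor <;> linarith

theorem aux_tail {K : Type*} [Field K] (v : MulRingNorm K)
    (R : ℝ) (hR : 0 < R) (F : Set (K × ℚ)) (hF : IsRGoodFilter v R F)
    (a : ℕ → K) (s : Finset ℕ) (hs : s.Nonempty) :
    filterPolyNorm v F (∑ i ∈ s, Polynomial.C (a i) * Polynomial.X ^ i) ≤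
      s.sup' hs (fun i => v (a i) * R ^ i) := by
  have hcont : Continuous fun x : ℝ => s.sup' hs (fun i => v (a i) * x ^ i) :=
    Continuous.finset_sup'_apply hs fun i _ => by fun_prop
  have ht := (hcont.tendsto R).mono_left (nhdsWithin_le_nhds (s := Set.Ioi R))
  refine ge_of_tendsto ht ?_
  filter_upwards [self_mem_nhdsWithin] with x hx
  obtain ⟨q, hq1, hq2⟩ := exists_rat_btwn (show R < x from hx)
  have hq0 : (0 : ℝ) < q := hR.trans hq1
  refine (aux_filter_le v F _ (0, q) (hF.large 0 (by simpa using hR.le) q hq1)).trans ?_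
  have hterm : ∀ i ∈ s, v (a i) * (q : ℝ) ^ i ≤ s.sup' hs (fun i => v (a i) * x ^ i) := by
    intro i hi
    refine le_trans ?_ (Finset.le_sup' (fun i => v (a i) * x ^ i) hi)
    have := apply_nonneg v (a i)
    gcongr
  refine ciSup_le fun i => ?_
  simp only [Polynomial.taylor_zero, Polynomial.finset_sum_coeff, Polynomial.coeff_C_mul,
    Polynomial.coeff_X_pow, mul_ite, mul_one, mul_zero, Finset.sum_ite_eq]
  split_ifs with hi
  · exact hterm i hi
  · obtain ⟨j, hj⟩ := hs
    have := hterm j hj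
    have h0 : 0 ≤ v (a j) * (q : ℝ) ^ j := mul_nonneg (apply_nonneg v _) (by positivity)
    simp only [map_zero, zero_mul]
    linarith

/-- Let `F` be an `R`-good filter, `|·|_F` the induced seminorm on `K[T]`, and let
`Σ_{i≥0} a_i T^i` be a power series with `|a_i|·R^i → 0`.  Then the partial sums
`s n = |Σ_{i=0}^n a_i T^i|_F` satisfy `|s N − s M| ≤ max_{M+1 ≤ i ≤ N} |a_i|·R^i`
for all `M < N`; consequently `s` is a Cauchy sequence and converges. -/
theorem filterPolyNorm_partial_sums_cauchy
    {K : Type*} [Field K] [IsAlgClosed K] (v : MulRingNorm K)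
    (hna : IsNonarchimedean v) (hcomp : IsNormComplete v)
    (R : ℝ) (hR : 0 < R)
    (F : Set (K × ℚ)) (hF : IsRGoodFilter v R F)
    (a : ℕ → K) (ha : Tendsto (fun i : ℕ => v (a i) * R ^ i) atTop (nhds 0)) :
    (∀ M N : ℕ, ∀ h : M < N,
      |filterPolyNorm v F (∑ i ∈ Finset.range (N + 1), Polynomial.C (a i) * Polynomial.X ^ i) -
        filterPolyNorm v F (∑ i ∈ Finset.range (M + 1), Polynomial.C (a i) * Polynomial.X ^ i)| ≤
      (Finset.Icc (M + 1) N).sup' (Finset.nonempty_Icc.mpr h)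
        (fun i => v (a i) * R ^ i)) ∧
    (∃ L : ℝ, Tendsto
      (fun n : ℕ => filterPolyNorm v F
        (∑ i ∈ Finset.range (n + 1), Polynomial.C (a i) * Polynomial.X ^ i))
      atTop (nhds L)) := by
  have key : ∀ M N : ℕ, ∀ h : M < N,
      |filterPolyNorm v F (∑ i ∈ Finset.range (N + 1), Polynomial.C (a i) * Polynomial.X ^ i) -
        filterPolyNorm v F (∑ i ∈ Finset.range (M + 1), Polynomial.C (a i) * Polynomial.X ^ i)| ≤
      (Finset.Icc (M + 1) N).sup' (Finset.nonempty_Icc.mpr h)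
        (fun i => v (a i) * R ^ i) := by
    intro M N h
    refine (aux_filter_sub v hna R F hF _ _).trans ?_
    rw [← Finset.sum_Ico_eq_sub _ (show M + 1 ≤ N + 1 by omega)]
    have e : Finset.Ico (M + 1) (N + 1) = Finset.Icc (M + 1) N := by
      ext; simp
    rw [e]
    exact aux_tail v R hR F hF a _ _
  refine ⟨key, ?_⟩
  apply cauchySeq_tendsto_of_complete
  rw [Metric.cauchySeq_iff']
  intro ε hε
  obtain ⟨n₀, hn₀⟩ := eventually_atTop.mp (ha.eventually_lt_const hε)
  refine ⟨n₀, fun n hn => ?_⟩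
  rcases hn.eq_or_lt with rfl | hlt
  · simpa using hε
  · rw [Real.dist_eq]
    refine (key n₀ n hlt).trans_lt ?_
    rw [Finset.sup'_lt_iff]
    intro i hi
    exact hn₀ i (by rw [Finset.mem_Icc] at hi; omega)
end
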